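/- Let λ be a Lévy measure on (0,∞). For every r > 0, the following identity holds in [0,∞]: η̄(r) = r^{-(1+2/d)} · (d^{d/2} / (πκ (d+2)^{d/2+1} Γ(d/2 + 1))) · ∫_0^∞ e^{-u} u^{d/2} M_{1+2/d}(D r e^{u d/(d+2)}) du, where Γ is the Gamma function. -/

import Mathlib

open MeasureTheory Real Filter Set
open scoped ENNReal Topology

noncomputable section

/-- The heat kernel on `ℝ^d` with diffusion constant `κ`. -/
def heatKernel (d : ℕ) (κ : ℝ) (s : ℝ) (x : EuclideanSpace ℝ (Fin d)) : ℝ :=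
  (2 * π * κ * s) ^ (-(d : ℝ) / 2) * Real.exp (-‖x‖ ^ 2 / (2 * κ * s))

/-- A Lévy measure on `(0,∞)`: a nonzero Borel measure carried by `(0,∞)`
with `∫ min(1, z²) λ(dz) < ∞`. -/
def IsLevyMeasure (lam : Measure ℝ) : Prop :=
  lam ≠ 0 ∧ lam (Set.Iic 0) = 0 ∧
    ∫⁻ z in Set.Ioi (0 : ℝ), ENNReal.ofReal (min 1 (z ^ 2)) ∂lam < ⊤

/-- `η̄(r) = (Leb ⊗ Leb ⊗ λ)({(s,y,z) ∈ (0,t] × ℝ^d × (0,∞) : g(s,y) z > r})`. -/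
def etaBar (d : ℕ) (κ t : ℝ) (lam : Measure ℝ) (r : ℝ) : ℝ≥0∞ :=
  (volume.prod (volume.prod lam))
    {p : ℝ × (EuclideanSpace ℝ (Fin d)) × ℝ |
      p.1 ∈ Set.Ioc (0 : ℝ) t ∧ p.2.2 ∈ Set.Ioi (0 : ℝ) ∧
        r < heatKernel d κ p.1 p.2.1 * p.2.2}

/-- `η̄₀(r)`, the analogue of `η̄` with the restriction `|y| ≤ 1/2`. -/
def etaBar0 (d : ℕ) (κ t : ℝ) (lam : Measure ℝ) (r : ℝ) : ℝ≥0∞ :=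
  (volume.prod (volume.prod lam))
    {p : ℝ × (EuclideanSpace ℝ (Fin d)) × ℝ |
      p.1 ∈ Set.Ioc (0 : ℝ) t ∧ p.2.2 ∈ Set.Ioi (0 : ℝ) ∧ ‖p.2.1‖ ≤ 1 / 2 ∧
        r < heatKernel d κ p.1 p.2.1 * p.2.2}

/-- `η̄_A(r)`, where the heat kernel is evaluated at `dist(y, A)`. -/
def etaBarA (d : ℕ) (κ t : ℝ) (lam : Measure ℝ)
    (A : Set (EuclideanSpace ℝ (Fin d))) (r : ℝ) : ℝ≥0∞ :=
  (volume.prod (volume.prod lam))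
    {p : ℝ × (EuclideanSpace ℝ (Fin d)) × ℝ |
      p.1 ∈ Set.Ioc (0 : ℝ) t ∧ p.2.2 ∈ Set.Ioi (0 : ℝ) ∧
        r < (2 * π * κ * p.1) ^ (-(d : ℝ) / 2) *
            Real.exp (-(Metric.infDist p.2.1 A) ^ 2 / (2 * κ * p.1)) * p.2.2}

/-- `τ̄(r) = (Leb ⊗ λ)({(s,z) ∈ (0,t] × (0,∞) : (2πκs)^{-d/2} z > r})`. -/
def tauBar (d : ℕ) (κ t : ℝ) (lam : Measure ℝ) (r : ℝ) : ℝ≥0∞ :=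
  (volume.prod lam)
    {p : ℝ × ℝ | p.1 ∈ Set.Ioc (0 : ℝ) t ∧ p.2 ∈ Set.Ioi (0 : ℝ) ∧
      r < (2 * π * κ * p.1) ^ (-(d : ℝ) / 2) * p.2}

/-- The truncated moment `M_γ(x) = ∫_{(0,x]} z^γ λ(dz)`. -/
def Mgamma (lam : Measure ℝ) (γ x : ℝ) : ℝ≥0∞ :=
  ∫⁻ z in Set.Ioc (0 : ℝ) x, ENNReal.ofReal (z ^ γ) ∂lam

/-- A measurable function, positive on `[1,∞)`, is slowly varying at infinity if
`ℓ(cx)/ℓ(x) → 1` as `x → ∞` for every `c > 0`. -/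
def SlowlyVarying (ℓ : ℝ → ℝ) : Prop :=
  Measurable ℓ ∧ (∀ x ≥ (1 : ℝ), 0 < ℓ x) ∧
    ∀ c > (0 : ℝ), Tendsto (fun x => ℓ (c * x) / ℓ x) atTop (𝓝 1)

/-- Regular variation at infinity with index `-α`: `f` is eventually positive and
`f(cr)/f(r) → c^{-α}` as `r → ∞` for every `c > 0`. -/
def RegVaryNeg (f : ℝ → ℝ) (α : ℝ) : Prop :=
  (∀ᶠ r in atTop, 0 < f r) ∧
    ∀ c > (0 : ℝ), Tendsto (fun r => f (c * r) / f r) atTop (𝓝 (c ^ (-α)))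

/-- Condition (E): the necessary and sufficient condition for existence of the solution. -/
def ConditionE (d : ℕ) (lam : Measure ℝ) : Prop :=
  (∫⁻ z in Set.Ioi (1 : ℝ), ENNReal.ofReal (Real.log z ^ ((d : ℝ) / 2)) ∂lam < ⊤) ∧
  (d = 1 → ∫⁻ z in Set.Ioc (0 : ℝ) 1, ENNReal.ofReal (z ^ 2) ∂lam < ⊤) ∧
  (d = 2 → ∫⁻ z in Set.Ioc (0 : ℝ) 1, ENNReal.ofReal (z ^ 2 * |Real.log z|) ∂lam < ⊤) ∧
  (3 ≤ d → ∫⁻ z in Set.Ioc (0 : ℝ) 1, ENNReal.ofReal (z ^ (1 + 2 / (d : ℝ))) ∂lam < ⊤)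

/-- Condition (F): `∫_{(0,1)} z^{2/d} λ(dz) < ∞` if `d ≠ 2`,
and `∫_{(0,1)} z |log z| λ(dz) < ∞` if `d = 2`. -/
def ConditionF (d : ℕ) (lam : Measure ℝ) : Prop :=
  (d ≠ 2 → ∫⁻ z in Set.Ioo (0 : ℝ) 1, ENNReal.ofReal (z ^ ((2 : ℝ) / d)) ∂lam < ⊤) ∧
  (d = 2 → ∫⁻ z in Set.Ioo (0 : ℝ) 1, ENNReal.ofReal (z * |Real.log z|) ∂lam < ⊤)

theorem IsLevyMeasure.sigmaFinite {lam : Measure ℝ} (h : IsLevyMeasure lam) :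
    SigmaFinite lam := by
  obtain ⟨-, h0, hint⟩ := h
  refine ⟨⟨⟨fun n : ℕ => Iic 0 ∪ Ici (1 / ((n : ℝ) + 1)), fun _ => mem_univ _, fun n => ?_, ?_⟩⟩⟩
  · refine (measure_union_le _ _).trans_lt ?_
    rw [h0, zero_add]
    have hn : (0 : ℝ) < 1 / ((n : ℝ) + 1) := by positivity
    have hε : (0 : ℝ) < min 1 ((1 / ((n : ℝ) + 1)) ^ 2) := lt_min one_pos (by positivity)
    have hle := meas_ge_le_lintegral_div (μ := lam.restrict (Ioi 0))
      (f := fun z : ℝ => ENNReal.ofReal (min 1 (z ^ 2))) (by fun_prop)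
      (ε := ENNReal.ofReal (min 1 ((1 / ((n : ℝ) + 1)) ^ 2)))
      (ENNReal.ofReal_pos.2 hε).ne' ENNReal.ofReal_ne_top
    refine lt_of_le_of_lt ?_ (hle.trans_lt (ENNReal.div_lt_top hint.ne (ENNReal.ofReal_pos.2 hε).ne'))
    have hsub : Ici (1 / ((n : ℝ) + 1)) ⊆ Ioi (0 : ℝ) := fun z hz => hn.trans_le hz
    rw [← inter_eq_self_of_subset_left hsub, ← Measure.restrict_apply measurableSet_Ici]
    refine measure_mono fun z hz => ENNReal.ofReal_le_ofReal (min_le_min_left _ ?_)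
    exact pow_le_pow_left₀ hn.le hz 2
  · refine eq_univ_of_forall fun z => mem_iUnion.2 ?_
    rcases le_or_gt z 0 with hz | hz
    · exact ⟨0, Or.inl hz⟩
    · obtain ⟨n, hn⟩ := exists_nat_one_div_lt hz
      exact ⟨n, Or.inr hn.le⟩

/-- The time `s` at which `(2πκs)^{d/2} = p e^{-ud/(d+2)}`. -/
def levelTime (d : ℕ) (κ p u : ℝ) : ℝ :=
  p ^ (2 / (d : ℝ)) / (2 * π * κ) * Real.exp (-(2 / ((d : ℝ) + 2)) * u)

section levelTime

variable {d : ℕ} {κ p : ℝ}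

theorem levelTime_pos (hκ : 0 < κ) (hp : 0 < p) (u : ℝ) : 0 < levelTime d κ p u := by
  unfold levelTime
  positivity

theorem two_pi_mul_levelTime (hκ : 0 < κ) (u : ℝ) :
    2 * π * κ * levelTime d κ p u =
      p ^ (2 / (d : ℝ)) * Real.exp (-(2 / ((d : ℝ) + 2)) * u) := by
  unfold levelTime
  field_simp

theorem two_pi_mul_levelTime_rpow (hd : 1 ≤ d) (hκ : 0 < κ) (hp : 0 < p) (u : ℝ) :
    (2 * π * κ * levelTime d κ p u) ^ ((d : ℝ) / 2) =
      p * Real.exp (-(u * d / ((d : ℝ) + 2))) := by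
  have hd0 : (0 : ℝ) < d := by exact_mod_cast hd
  rw [two_pi_mul_levelTime hκ, Real.mul_rpow (by positivity) (by positivity),
    ← Real.rpow_mul hp.le, ← Real.exp_mul, show 2 / (d : ℝ) * (d / 2) = 1 by field_simp,
    Real.rpow_one]
  congr 2
  field_simp

theorem hasDerivAt_levelTime (u : ℝ) :
    HasDerivAt (levelTime d κ p) (-(2 / ((d : ℝ) + 2)) * levelTime d κ p u) u := by
  unfold levelTime
  have h := (((hasDerivAt_id u).const_mul (-(2 / ((d : ℝ) + 2)))).exp).const_mul
    (p ^ (2 / (d : ℝ)) / (2 * π * κ))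
  refine h.congr_deriv ?_
  simp only [id]
  ring

theorem levelTime_injective (hκ : 0 < κ) (hp : 0 < p) :
    Function.Injective (levelTime d κ p) := by
  intro u v huv
  have hc : p ^ (2 / (d : ℝ)) / (2 * π * κ) ≠ 0 := by positivity
  have ha : -(2 / ((d : ℝ) + 2)) ≠ 0 := neg_ne_zero.2 (by positivity)
  exact mul_left_cancel₀ ha (Real.exp_injective (mul_left_cancel₀ hc huv))

theorem exists_levelTime_eq (hκ : 0 < κ) (hp : 0 < p) {s : ℝ} (hs : 0 < s) :
    ∃ u, levelTime d κ p u = s := by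
  have hc : 0 < p ^ (2 / (d : ℝ)) / (2 * π * κ) := by positivity
  refine ⟨-((d : ℝ) + 2) / 2 * Real.log (s / (p ^ (2 / (d : ℝ)) / (2 * π * κ))), ?_⟩
  unfold levelTime
  rw [← mul_assoc, show -(2 / ((d : ℝ) + 2)) * (-((d : ℝ) + 2) / 2) = 1 by field_simp, one_mul,
    Real.exp_log (by positivity)]
  field_simp

theorem levelTime_le_iff (hd : 1 ≤ d) (hκ : 0 < κ) (hp : 0 < p) {t : ℝ} (ht : 0 < t) (u : ℝ) :
    levelTime d κ p u ≤ t ↔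
      p ≤ (2 * π * κ * t) ^ ((d : ℝ) / 2) * Real.exp (u * d / ((d : ℝ) + 2)) := by
  have hd0 : (0 : ℝ) < d := by exact_mod_cast hd
  have hs := levelTime_pos (d := d) hκ hp u
  have hc : 0 < 2 * π * κ := by positivity
  rw [← mul_le_mul_iff_right₀ hc, ← Real.rpow_le_rpow_iff (z := (d : ℝ) / 2) (by positivity)
    (by positivity) (by positivity), two_pi_mul_levelTime_rpow hd hκ hp, Real.exp_neg,
    ← div_eq_mul_inv, div_le_iff₀ (Real.exp_pos _)]

theorem lt_heatKernel_mul_iff (hd : 1 ≤ d) (hκ : 0 < κ) {r z : ℝ} (hr : 0 < r) (hz : 0 < z)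
    (u : ℝ) (y : EuclideanSpace ℝ (Fin d)) :
    r < heatKernel d κ (levelTime d κ (z / r) u) y * z ↔
      ‖y‖ ^ 2 < 2 * κ * levelTime d κ (z / r) u * (u * d / ((d : ℝ) + 2)) := by
  have hp : 0 < z / r := by positivity
  have hs := levelTime_pos (d := d) hκ hp u
  have hpow := two_pi_mul_levelTime_rpow hd hκ hp u
  set s := levelTime d κ (z / r) u
  have hval : heatKernel d κ s y * z =
      r * Real.exp (u * d / ((d : ℝ) + 2) - ‖y‖ ^ 2 / (2 * κ * s)) := by
    unfold heatKernel
    rw [neg_div, Real.rpow_neg (by positivity), hpow, mul_inv, ← Real.exp_neg, neg_neg, inv_div,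
      sub_eq_add_neg, Real.exp_add, neg_div]
    field_simp
  rw [hval, lt_mul_iff_one_lt_right hr, Real.one_lt_exp_iff, sub_pos, div_lt_iff₀ (by positivity),
    mul_comm (u * d / ((d : ℝ) + 2))]

theorem volume_heatKernel_superlevel (hd : 1 ≤ d) (hκ : 0 < κ) {r z : ℝ} (hr : 0 < r)
    (hz : 0 < z) {u : ℝ} (hu : 0 < u) :
    volume {y : EuclideanSpace ℝ (Fin d) | r < heatKernel d κ (levelTime d κ (z / r) u) y * z} =
      ENNReal.ofReal (z / r * Real.exp (-(u * d / ((d : ℝ) + 2))) *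
        (u * d / ((d : ℝ) + 2)) ^ ((d : ℝ) / 2) / Real.Gamma ((d : ℝ) / 2 + 1)) := by
  have hd0 : (0 : ℝ) < d := by exact_mod_cast hd
  have hp : 0 < z / r := by positivity
  have hpow := two_pi_mul_levelTime_rpow hd hκ hp u
  have hs := levelTime_pos (d := d) hκ hp u
  have : Nonempty (Fin d) := ⟨⟨0, hd⟩⟩
  have hball : {y : EuclideanSpace ℝ (Fin d) |
      r < heatKernel d κ (levelTime d κ (z / r) u) y * z} =
      Metric.ball 0 (√(2 * κ * levelTime d κ (z / r) u * (u * d / ((d : ℝ) + 2)))) := by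
    ext y
    rw [mem_ofPred_eq, lt_heatKernel_mul_iff hd hκ hr hz, mem_ball_zero_iff,
      Real.lt_sqrt (norm_nonneg y)]
  rw [hball, EuclideanSpace.volume_ball, Fintype.card_fin, ← ENNReal.ofReal_pow (Real.sqrt_nonneg _),
    ← ENNReal.ofReal_mul (by positivity), ← hpow]
  congr 1
  set s := levelTime d κ (z / r) u
  set w := u * d / ((d : ℝ) + 2)
  have hw0 : 0 < w := by positivity
  rw [mul_div_assoc', ← mul_pow, ← Real.sqrt_mul (by positivity),
    ← Real.mul_rpow (by positivity) hw0.le, ← Real.rpow_natCast, Real.sqrt_eq_rpow,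
    ← Real.rpow_mul (by positivity)]
  congr 2 <;> ring

theorem volume_heatKernel_superlevel_of_nonpos (hd : 1 ≤ d) (hκ : 0 < κ) {r z : ℝ} (hr : 0 < r)
    (hz : 0 < z) {u : ℝ} (hu : u ≤ 0) :
    volume {y : EuclideanSpace ℝ (Fin d) | r < heatKernel d κ (levelTime d κ (z / r) u) y * z} =
      0 := by
  have hs := levelTime_pos (d := d) hκ (div_pos hz hr) u
  convert! measure_empty
  · refine eq_empty_of_forall_notMem fun y hy => ?_
    rw [mem_ofPred_eq, lt_heatKernel_mul_iff hd hκ hr hz] at hy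
    have h1 : u * d / ((d : ℝ) + 2) ≤ 0 :=
      div_nonpos_of_nonpos_of_nonneg (mul_nonpos_of_nonpos_of_nonneg hu (by positivity))
        (by positivity)
    nlinarith [sq_nonneg ‖y‖, mul_nonneg (by positivity : 0 ≤ 2 * κ * levelTime d κ (z / r) u)
      (neg_nonneg.2 h1)]
  · infer_instance

theorem abs_deriv_levelTime_mul_volume (hd : 1 ≤ d) (hκ : 0 < κ) {r z : ℝ} (hr : 0 < r)
    (hz : 0 < z) {u : ℝ} (hu : 0 < u) :
    2 / ((d : ℝ) + 2) * levelTime d κ (z / r) u *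
      (z / r * Real.exp (-(u * d / ((d : ℝ) + 2))) *
        (u * d / ((d : ℝ) + 2)) ^ ((d : ℝ) / 2) / Real.Gamma ((d : ℝ) / 2 + 1)) =
      r ^ (-(1 + 2 / (d : ℝ))) * ((d : ℝ) ^ ((d : ℝ) / 2) /
        (π * κ * ((d : ℝ) + 2) ^ ((d : ℝ) / 2 + 1) * Real.Gamma ((d : ℝ) / 2 + 1))) *
        (Real.exp (-u) * u ^ ((d : ℝ) / 2) * z ^ (1 + 2 / (d : ℝ))) := by
  have hd0 : (0 : ℝ) < d := by exact_mod_cast hd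
  have hG : 0 < Real.Gamma ((d : ℝ) / 2 + 1) := Real.Gamma_pos_of_pos (by positivity)
  have hexp : Real.exp (-u) =
      Real.exp (-(2 / ((d : ℝ) + 2)) * u) * Real.exp (-(u * d / ((d : ℝ) + 2))) := by
    rw [← Real.exp_add]
    congr 1
    field_simp
    ring
  unfold levelTime
  rw [hexp, Real.rpow_neg hr.le, Real.rpow_add hr, Real.rpow_add hz, Real.rpow_one, Real.rpow_one,
    Real.rpow_add (by positivity : (0 : ℝ) < (d : ℝ) + 2), Real.rpow_one,
    Real.div_rpow hz.le hr.le, Real.div_rpow (by positivity) (by positivity),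
    Real.mul_rpow hu.le hd0.le]
  field_simp

theorem image_levelTime (hd : 1 ≤ d) (hκ : 0 < κ) (hp : 0 < p) {t : ℝ} (ht : 0 < t) :
    levelTime d κ p ''
      {u | p ≤ (2 * π * κ * t) ^ ((d : ℝ) / 2) * Real.exp (u * d / ((d : ℝ) + 2))} = Ioc 0 t := by
  ext s
  constructor
  · rintro ⟨u, hu, rfl⟩
    exact ⟨levelTime_pos hκ hp u, (levelTime_le_iff hd hκ hp ht u).2 hu⟩
  · rintro ⟨hs, hst⟩
    obtain ⟨u, rfl⟩ := exists_levelTime_eq (d := d) hκ hp hs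
    exact ⟨u, (levelTime_le_iff hd hκ hp ht u).1 hst, rfl⟩

theorem setLIntegral_volume_heatKernel_superlevel (hd : 1 ≤ d) (hκ : 0 < κ) {t r z : ℝ}
    (ht : 0 < t) (hr : 0 < r) (hz : 0 < z) :
    ∫⁻ s in Ioc 0 t, volume {y : EuclideanSpace ℝ (Fin d) | r < heatKernel d κ s y * z} =
      ∫⁻ u in Ioi (0 : ℝ),
        {u | z ≤ (2 * π * κ * t) ^ ((d : ℝ) / 2) * r * Real.exp (u * d / ((d : ℝ) + 2))}.indicator
          (fun u => ENNReal.ofReal (r ^ (-(1 + 2 / (d : ℝ))) * ((d : ℝ) ^ ((d : ℝ) / 2) /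
            (π * κ * ((d : ℝ) + 2) ^ ((d : ℝ) / 2 + 1) * Real.Gamma ((d : ℝ) / 2 + 1))) *
            (Real.exp (-u) * u ^ ((d : ℝ) / 2) * z ^ (1 + 2 / (d : ℝ))))) u := by
  have hp : 0 < z / r := by positivity
  have hset : {u : ℝ | z ≤ (2 * π * κ * t) ^ ((d : ℝ) / 2) * r *
        Real.exp (u * d / ((d : ℝ) + 2))} =
      {u | z / r ≤ (2 * π * κ * t) ^ ((d : ℝ) / 2) * Real.exp (u * d / ((d : ℝ) + 2))} := by
    ext u
    rw [mem_ofPred_eq, mem_ofPred_eq, div_le_iff₀ hr, mul_right_comm]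
  have hmeas : MeasurableSet
      {u | z / r ≤ (2 * π * κ * t) ^ ((d : ℝ) / 2) * Real.exp (u * d / ((d : ℝ) + 2))} :=
    measurableSet_le (by fun_prop) (by fun_prop)
  rw [hset, ← image_levelTime hd hκ hp ht,
    lintegral_image_eq_lintegral_abs_deriv_mul hmeas
      (fun u _ => (hasDerivAt_levelTime u).hasDerivWithinAt) (levelTime_injective hκ hp).injOn,
    ← lintegral_indicator hmeas, ← lintegral_indicator measurableSet_Ioi]
  refine lintegral_congr fun u => ?_
  rcases le_or_gt u 0 with hu | hu
  · rw [indicator_of_notMem (s := Ioi 0) (by simpa using hu), indicator_apply_eq_zero]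
    intro _
    rw [volume_heatKernel_superlevel_of_nonpos hd hκ hr hz hu, mul_zero]
  · have hneg : |-(2 / ((d : ℝ) + 2)) * levelTime d κ (z / r) u| =
        2 / ((d : ℝ) + 2) * levelTime d κ (z / r) u := by
      have := levelTime_pos (d := d) hκ hp u
      rw [neg_mul, abs_neg, abs_of_pos (by positivity)]
    rw [indicator_of_mem (s := Ioi 0) hu, indicator_apply, indicator_apply, hneg,
      volume_heatKernel_superlevel hd hκ hr hz hu,
      ← ENNReal.ofReal_mul (by have := levelTime_pos (d := d) hκ hp u; positivity),
      abs_deriv_levelTime_mul_volume hd hκ hr hz hu]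

end levelTime

theorem measurable_heatKernel (d : ℕ) (κ : ℝ) :
    Measurable fun p : ℝ × EuclideanSpace ℝ (Fin d) => heatKernel d κ p.1 p.2 := by
  unfold heatKernel
  fun_prop

theorem etaBar_eq_lintegral (d : ℕ) (κ t : ℝ) (lam : Measure ℝ) [SFinite lam] (r : ℝ) :
    etaBar d κ t lam r = ∫⁻ z in Ioi (0 : ℝ), (∫⁻ s in Ioc 0 t,
      volume {y : EuclideanSpace ℝ (Fin d) | r < heatKernel d κ s y * z}) ∂lam := by
  have hB : MeasurableSet {q : (ℝ × ℝ) × EuclideanSpace ℝ (Fin d) |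
      r < heatKernel d κ q.1.1 q.2 * q.1.2} :=
    measurableSet_lt measurable_const
      (((measurable_heatKernel d κ).comp (by fun_prop :
        Measurable fun q : (ℝ × ℝ) × EuclideanSpace ℝ (Fin d) => (q.1.1, q.2))).mul
        (by fun_prop))
  have hF : Measurable fun q : ℝ × ℝ =>
      volume {y : EuclideanSpace ℝ (Fin d) | r < heatKernel d κ q.1 y * q.2} :=
    measurable_measure_prodMk_left hB
  have hA : MeasurableSet {p : ℝ × (EuclideanSpace ℝ (Fin d)) × ℝ |
      p.1 ∈ Ioc (0 : ℝ) t ∧ p.2.2 ∈ Ioi (0 : ℝ) ∧ r < heatKernel d κ p.1 p.2.1 * p.2.2} := by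
    have hφ : Measurable fun p : ℝ × (EuclideanSpace ℝ (Fin d)) × ℝ => ((p.1, p.2.2), p.2.1) := by
      fun_prop
    refine (((measurableSet_Ioc (a := 0) (b := t)).preimage measurable_fst).inter
      (((measurableSet_Ioi (a := 0)).preimage (measurable_snd.comp measurable_snd)).inter
        (hB.preimage hφ))).congr ?_
    ext p
    exact Iff.rfl
  rw [lintegral_lintegral_swap (f := fun z s => volume {y : EuclideanSpace ℝ (Fin d) |
      r < heatKernel d κ s y * z}) (hF.comp measurable_swap).aemeasurable, etaBar,
    Measure.prod_apply hA, ← lintegral_indicator measurableSet_Ioc]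
  refine lintegral_congr fun s => ?_
  rw [Measure.prod_apply_symm (hA.preimage measurable_prodMk_left)]
  by_cases hs : s ∈ Ioc 0 t
  · rw [indicator_of_mem hs, ← lintegral_indicator measurableSet_Ioi]
    refine lintegral_congr fun z => ?_
    by_cases hz : z ∈ Ioi (0 : ℝ)
    · rw [indicator_of_mem hz]
      congr 1
      ext y
      exact ⟨fun h => h.2.2, fun h => ⟨hs, hz, h⟩⟩
    · rw [indicator_of_notMem hz]
      convert! measure_empty (μ := (volume : Measure (EuclideanSpace ℝ (Fin d))))
      exact eq_empty_of_forall_notMem fun y h => hz h.2.1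
  · rw [indicator_of_notMem hs, ← lintegral_zero (μ := lam)]
    refine lintegral_congr fun z => ?_
    convert! measure_empty (μ := (volume : Measure (EuclideanSpace ℝ (Fin d))))
    exact eq_empty_of_forall_notMem fun y h => hs h.1

/-- Lemma 2.1: exact formula for `η̄(r)`, with `D = (2πκt)^{d/2}`:
`η̄(r) = r^{-(1+2/d)} · d^{d/2}/(πκ(d+2)^{d/2+1}Γ(d/2+1)) ·
∫_0^∞ e^{-u} u^{d/2} M_{1+2/d}(D r e^{ud/(d+2)}) du`. -/
theorem stmt_2 (d : ℕ) (hd : 1 ≤ d) (κ t : ℝ) (hκ : 0 < κ) (ht : 0 < t)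
    (lam : Measure ℝ) (hlam : IsLevyMeasure lam)
    (D : ℝ) (hD : D = (2 * π * κ * t) ^ ((d : ℝ) / 2))
    (r : ℝ) (hr : 0 < r) :
    etaBar d κ t lam r =
      ENNReal.ofReal (r ^ (-(1 + 2 / (d : ℝ))) *
          ((d : ℝ) ^ ((d : ℝ) / 2) /
            (π * κ * ((d : ℝ) + 2) ^ ((d : ℝ) / 2 + 1) * Real.Gamma ((d : ℝ) / 2 + 1)))) *
        ∫⁻ u in Set.Ioi (0 : ℝ),
          ENNReal.ofReal (Real.exp (-u) * u ^ ((d : ℝ) / 2)) *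
            Mgamma lam (1 + 2 / (d : ℝ)) (D * r * Real.exp (u * d / ((d : ℝ) + 2))) := by
  have := hlam.sigmaFinite
  subst hD
  rw [etaBar_eq_lintegral, setLIntegral_congr_fun measurableSet_Ioi
    fun z (hz : z ∈ Ioi (0 : ℝ)) => setLIntegral_volume_heatKernel_superlevel hd hκ ht hr hz]
  have hd0 : (0 : ℝ) < d := by exact_mod_cast hd
  have hG : 0 < Real.Gamma ((d : ℝ) / 2 + 1) := Real.Gamma_pos_of_pos (by positivity)
  set c := r ^ (-(1 + 2 / (d : ℝ))) * ((d : ℝ) ^ ((d : ℝ) / 2) /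
    (π * κ * ((d : ℝ) + 2) ^ ((d : ℝ) / 2 + 1) * Real.Gamma ((d : ℝ) / 2 + 1)))
  have hc0 : 0 ≤ c := by positivity
  have hmeas : MeasurableSet {q : ℝ × ℝ | q.1 ≤ (2 * π * κ * t) ^ ((d : ℝ) / 2) * r *
      Real.exp (q.2 * d / ((d : ℝ) + 2))} := measurableSet_le (by fun_prop) (by fun_prop)
  rw [lintegral_lintegral_swap, ← lintegral_const_mul' _ _ ENNReal.ofReal_ne_top]
  · refine setLIntegral_congr_fun measurableSet_Ioi fun u hu => ?_
    have hu0 : 0 < u := hu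
    have he : 0 ≤ Real.exp (-u) * u ^ ((d : ℝ) / 2) := by positivity
    set x := (2 * π * κ * t) ^ ((d : ℝ) / 2) * r * Real.exp (u * d / ((d : ℝ) + 2))
    rw [Mgamma, ← mul_assoc, ← lintegral_const_mul _ (by fun_prop), ← Ioi_inter_Iic, inter_comm,
      ← setLIntegral_indicator measurableSet_Iic]
    refine lintegral_congr fun z => ?_
    simp only [indicator_apply, mem_ofPred_eq, mem_Iic, x]
    rw [← ENNReal.ofReal_mul hc0, ← ENNReal.ofReal_mul (mul_nonneg hc0 he), ← mul_assoc c]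
  · exact (Measurable.indicator (f := fun q : ℝ × ℝ => ENNReal.ofReal (c *
      (Real.exp (-q.2) * q.2 ^ ((d : ℝ) / 2) * q.1 ^ (1 + 2 / (d : ℝ))))) (by fun_prop)
      hmeas).aemeasurable
end
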